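/- Let A and B be finite nonempty sets, let I be a finite nonempty index set, let (h_l)_{l∈I} be a family of functions from A to B, and let ε ≥ 0 be a real number such that for all distinct α₁, α₂ ∈ A and all β₁, β₂ ∈ B, |{l ∈ I : h_l(α₁) = β₁ and h_l(α₂) = β₂}| ≤ ε·|I|/|B|. Let i₁, …, i_K be K ≥ 1 distinct elements of A and set 𝒦 = {i₁, …, i_K}. Let V be uniformly distributed on I, and say receiver i ∈ A decodes T for index l ∈ I if h_l(i) = h_l(i_j) for some j ∈ {1, …, K}, and decodes F otherwise. Then: (a) for every i ∈ 𝒦, the probability that i decodes F is 0 (the type I error probability is zero); (b) for every i ∈ A \ 𝒦, the probability that i decodes T is at most K·ε (the type II error probability is at most Kε). -/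

import Mathlib

/-- In an `ε`-almost strongly universal family, two distinct points collide under at most
`ε * |I|` of the functions. -/
theorem card_collision_le {A B I : Type*} [Fintype B] [Fintype I] [Nonempty B] [DecidableEq B]
    (h : I → A → B) (ε : ℝ) {a b : A}
    (hab : ∀ β₁ β₂ : B,
      ((Finset.univ.filter fun l : I => h l a = β₁ ∧ h l b = β₂).card : ℝ)
        ≤ ε * (Fintype.card I) / (Fintype.card B)) :
    ((Finset.univ.filter fun l : I => h l a = h l b).card : ℝ) ≤ ε * Fintype.card I := by
  have hB : (Fintype.card B : ℝ) ≠ 0 := by exact_mod_cast Fintype.card_ne_zero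
  classical
  have hsub : (Finset.univ.filter fun l : I => h l a = h l b) ⊆
      Finset.univ.biUnion fun β : B =>
        Finset.univ.filter fun l : I => h l a = β ∧ h l b = β := by
    intro l hl
    simpa [eq_comm] using hl
  calc ((Finset.univ.filter fun l : I => h l a = h l b).card : ℝ)
      ≤ ∑ β : B, ((Finset.univ.filter fun l : I => h l a = β ∧ h l b = β).card : ℝ) := by
        exact_mod_cast (Finset.card_le_card hsub).trans Finset.card_biUnion_le
    _ ≤ ∑ _β : B, ε * Fintype.card I / Fintype.card B :=
        Finset.sum_le_sum fun β _ => hab β β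
    _ = ε * Fintype.card I := by
        rw [Finset.sum_const, nsmul_eq_mul, Finset.card_univ]
        field_simp

/-- Noiseless-channel performance of the K-MOID code (Coding Scheme 1).
With an ε-almost strongly universal family `(h l)_{l ∈ I}` from `A` to `B`, winners
`i 0, …, i (K-1)` (distinct, `K ≥ 1`), and `V` uniform on `I`, receiver `a` decodes `T`
for index `l` iff `h l a = h l (i j)` for some `j`. Then:
(a) every winner decodes `F` with probability `0` (type I error probability is zero);
(b) every non-winner decodes `T` with probability at most `K * ε`. -/
theorem kmoid_noiseless_error
    {A B I : Type*} [Fintype A] [Fintype B] [Fintype I]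
    [Nonempty A] [Nonempty B] [Nonempty I] [DecidableEq B]
    (h : I → A → B) (ε : ℝ) (hε : 0 ≤ ε)
    (hASU : ∀ α₁ α₂ : A, α₁ ≠ α₂ → ∀ β₁ β₂ : B,
      ((Finset.univ.filter fun l : I => h l α₁ = β₁ ∧ h l α₂ = β₂).card : ℝ)
        ≤ ε * (Fintype.card I) / (Fintype.card B))
    (K : ℕ) (hK : 1 ≤ K) (i : Fin K → A) (hi : Function.Injective i) :
    (∀ a : A, (∃ j : Fin K, a = i j) →
      (PMF.uniformOfFintype I).toOuterMeasure
        {l : I | ¬ ∃ j : Fin K, h l a = h l (i j)} = 0) ∧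
    (∀ a : A, (∀ j : Fin K, a ≠ i j) →
      (PMF.uniformOfFintype I).toOuterMeasure
        {l : I | ∃ j : Fin K, h l a = h l (i j)} ≤ ENNReal.ofReal (K * ε)) := by
  refine ⟨?_, fun a ha => ?_⟩
  · rintro a ⟨j, rfl⟩
    have hempty : {l : I | ¬ ∃ j' : Fin K, h l (i j) = h l (i j')} = ∅ :=
      Set.eq_empty_of_forall_notMem fun l hl => hl ⟨j, rfl⟩
    rw [hempty, MeasureTheory.measure_empty]
  · have hI : (0 : ℝ) < Fintype.card I := by exact_mod_cast Fintype.card_pos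
    have hcollide : ∀ j : Fin K, (PMF.uniformOfFintype I).toOuterMeasure
        {l : I | h l a = h l (i j)} ≤ ENNReal.ofReal ε := by
      intro j
      rw [PMF.toOuterMeasure_uniformOfFintype_apply, Fintype.card_subtype,
        ← ENNReal.ofReal_natCast, ← ENNReal.ofReal_natCast, ← ENNReal.ofReal_div_of_pos hI]
      refine ENNReal.ofReal_le_ofReal ((div_le_iff₀ hI).2 ?_)
      exact card_collision_le h ε (hASU a (i j) (ha j))
    calc (PMF.uniformOfFintype I).toOuterMeasure {l : I | ∃ j : Fin K, h l a = h l (i j)}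
        ≤ ∑ j : Fin K, (PMF.uniformOfFintype I).toOuterMeasure {l : I | h l a = h l (i j)} := by
          rw [Set.ofPred_exists]
          exact MeasureTheory.measure_iUnion_fintype_le _ _
      _ ≤ ∑ _j : Fin K, ENNReal.ofReal ε := Finset.sum_le_sum fun j _ => hcollide j
      _ = ENNReal.ofReal (K * ε) := by
          rw [ENNReal.ofReal_mul (Nat.cast_nonneg K), ENNReal.ofReal_natCast]
          simp
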